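/- Let F be a field, q, A ∈ F with q ≠ 0, A ≠ 0, q − q⁻¹ ≠ 0 and A − A⁻¹ ≠ 0. Write {x} = x − x⁻¹ (for integer powers, {A^k} = A^k − A^{−k}), D = {A}/{q}. For k ∈ ℤ set Φ(k) = (A^{2k} − 1)/D and Φ̄(k) = (A^{−2k} − 1)/D. Then for all m, n ∈ ℕ and all i, j ∈ ℤ: A^{−2m−2n}·( D²·Φ(m+n) + D·(1 + (D − D⁻¹)·(Φ(j) + Φ̄(j)))·(1 + (D − D⁻¹)·(Φ(i) + Φ̄(i))) + D²·(D − D⁻¹)·Φ(i−j)·Φ̄(i−j) ) = D·( 1 + {Aq}·{A/q}·A^{−2m−2n}·( ({A^j}/{A})² + ({A^i}/{A})² + {Aq}·{A/q}·({A^j}/{A})²·({A^i}/{A})² − ({A^{i−j}}/{A})² ) ). -/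

import Mathlib

/-- The product of the two differentials `{Aq}{A/q}` equals `{A}² - {q}²`. -/
theorem bracket_mul_mul_bracket_div {F : Type*} [Field F] {q A : F} (hq : q ≠ 0) (hA : A ≠ 0) :
    (A * q - (A * q)⁻¹) * (A / q - (A / q)⁻¹) = (A - A⁻¹) ^ 2 - (q - q⁻¹) ^ 2 := by
  field_simp
  ring

/-- `A ^ (2k) + A ^ (-2k) - 2 = {A ^ k}²`. -/
theorem zpow_two_mul_add_zpow_neg {F : Type*} [Field F] {A : F} (hA : A ≠ 0) (k : ℤ) :
    (A ^ (2 * k) - 1) + (A ^ (-(2 * k)) - 1) = (A ^ k - A ^ (-k)) ^ 2 := by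
  have hk : A ^ k ≠ 0 := zpow_ne_zero k hA
  rw [zpow_neg, zpow_neg, mul_comm, zpow_mul, zpow_ofNat]
  field_simp
  ring

/-- `(A ^ (2k) - 1)(A ^ (-2k) - 1) = -{A ^ k}²`. -/
theorem zpow_two_mul_mul_zpow_neg {F : Type*} [Field F] {A : F} (hA : A ≠ 0) (k : ℤ) :
    (A ^ (2 * k) - 1) * (A ^ (-(2 * k)) - 1) = -(A ^ k - A ^ (-k)) ^ 2 := by
  have hk : A ^ k ≠ 0 := zpow_ne_zero k hA
  rw [zpow_neg, zpow_neg, mul_comm 2 k, zpow_mul, zpow_ofNat]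
  field_simp
  ring

/-- Differential expansion of the HOMFLY polynomial of the 4-parameter
generalized Kanenobu knot Kan(2m,2n,2j,2i): the cyclotomic function
factorizes the dependence on m+n from the dependence on i and j. -/
theorem kanenobu_four_parameter
    (F : Type*) [Field F] (q A : F) (hq : q ≠ 0) (hA : A ≠ 0)
    (hqq : q - q⁻¹ ≠ 0) (hAA : A - A⁻¹ ≠ 0)
    (D : F) (hD : D = (A - A⁻¹) / (q - q⁻¹))
    (Φ Φbar : ℤ → F)
    (hΦ : ∀ k : ℤ, Φ k = (A ^ (2 * k) - 1) / D)
    (hΦbar : ∀ k : ℤ, Φbar k = (A ^ (-(2 * k)) - 1) / D)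
    (br : ℤ → F) (hbr : ∀ k : ℤ, br k = A ^ k - A ^ (-k)) :
    ∀ (m n : ℕ) (i j : ℤ),
      A ^ (-(2 * (m : ℤ)) - 2 * (n : ℤ)) *
        (D ^ 2 * Φ ((m : ℤ) + n)
          + D * (1 + (D - D⁻¹) * (Φ j + Φbar j)) * (1 + (D - D⁻¹) * (Φ i + Φbar i))
          + D ^ 2 * (D - D⁻¹) * Φ (i - j) * Φbar (i - j)) =
      D * (1 + (A * q - (A * q)⁻¹) * (A / q - (A / q)⁻¹) *
        A ^ (-(2 * (m : ℤ)) - 2 * (n : ℤ)) *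
          ((br j / (A - A⁻¹)) ^ 2 + (br i / (A - A⁻¹)) ^ 2
            + (A * q - (A * q)⁻¹) * (A / q - (A / q)⁻¹) *
                (br j / (A - A⁻¹)) ^ 2 * (br i / (A - A⁻¹)) ^ 2
            - (br (i - j) / (A - A⁻¹)) ^ 2)) := by
  intro m n i j
  have hD0 : D ≠ 0 := hD ▸ div_ne_zero hAA hqq
  have hC : (A - A⁻¹) ^ 2 - (q - q⁻¹) ^ 2 = (A - A⁻¹) ^ 2 * (1 - D⁻¹ ^ 2) := by
    rw [hD, inv_div]
    generalize A - A⁻¹ = a at *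
    field_simp
  have hsum (k : ℤ) : Φ k + Φbar k = br k ^ 2 / D := by
    rw [hΦ, hΦbar, hbr, ← add_div, zpow_two_mul_add_zpow_neg hA]
  have hprod : Φ (i - j) * Φbar (i - j) = -br (i - j) ^ 2 / D ^ 2 := by
    rw [hΦ, hΦbar, hbr, div_mul_div_comm, zpow_two_mul_mul_zpow_neg hA, sq D]
  have hframe : A ^ (-(2 * (m : ℤ)) - 2 * (n : ℤ)) = (A ^ (2 * ((m : ℤ) + n)))⁻¹ := by
    rw [← zpow_neg]
    congr 1
    ring
  have hT : A ^ (2 * ((m : ℤ) + n)) ≠ 0 := zpow_ne_zero _ hA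
  rw [bracket_mul_mul_bracket_div hq hA, hC, hsum, hsum, mul_assoc (D ^ 2 * (D - D⁻¹)), hprod,
    hΦ, hframe]
  generalize A ^ (2 * ((m : ℤ) + n)) = T at *
  clear hC hD
  generalize A - A⁻¹ = a at *
  field_simp
  ring
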